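/- arXiv:1312.6165 — 2 statements merged into one kernel-verified Lean document; each statement's English description precedes it below -/
import Mathlib

section
/- There exists a constant C′, depending only on C_A, K_B, M_B and T, such that for all y, k ∈ E and t ∈ [t₀,T], ‖Y^{t₀,y+k}(t) − Y^{t₀,y}(t) − ξ^{t₀,y}(t)k‖ ≤ C′ ‖k‖². Consequently, for every t ∈ [t₀,T] the map y ↦ Y^{t₀,y}(t) is Fréchet differentiable from E to E with derivative ξ^{t₀,y}(t). -/
open MeasureTheory

/-- Operator spaces are equipped with the Borel σ-algebra of the norm topology. -/
noncomputable instance (priority := 100) {E F : Type*} [NormedAddCommGroup E]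
    [NormedSpace ℝ E] [NormedAddCommGroup F] [NormedSpace ℝ F] :
    MeasurableSpace (E →L[ℝ] F) := borel _

/-- A function `[t₀,T] → E` which is measurable and bounded. -/
def BddMeasOn {E : Type u} [NormedAddCommGroup E] [MeasurableSpace E]
    (f : ℝ → E) (t₀ T : ℝ) : Prop :=
  Measurable (fun t : Set.Icc t₀ T => f t) ∧ ∃ M, ∀ t ∈ Set.Icc t₀ T, ‖f t‖ ≤ M

/-- `Y` is a mild solution on `[t₀,T]` of `dY = AY dt + B(t,Y) dt + dz`. -/
def IsMildSolution {E : Type u} [NormedAddCommGroup E] [NormedSpace ℝ E]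
    (S : ℝ → E →L[ℝ] E) (B : ℝ → E → E) (t₀ T : ℝ)
    (y : E) (z : ℝ → E) (Y : ℝ → E) : Prop :=
  ∀ t ∈ Set.Icc t₀ T,
    Y t = S (t - t₀) y + (∫ s in t₀..t, S (t - s) (B s (Y s))) + z t

/-- `ξ` solves the first variation equation along `Y` on `[t₀,T]`. -/
def IsFirstVariation {E : Type u} [NormedAddCommGroup E] [NormedSpace ℝ E]
    (S : ℝ → E →L[ℝ] E) (DB : ℝ → E → E →L[ℝ] E) (t₀ T : ℝ)
    (Y : ℝ → E) (ξ : ℝ → E →L[ℝ] E) : Prop :=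
  ∀ t ∈ Set.Icc t₀ T, ∀ h : E,
    ξ t h = S (t - t₀) h + ∫ s in t₀..t, S (t - s) (DB s (Y s) (ξ s h))

section MeasurableDiscrete

open Set Filter Topology CantorScheme

/-- In a hereditarily Lindelöf space, a set with uncountable image contains a point all of whose
neighborhoods within the set have uncountable image. -/
theorem exists_forall_mem_nhdsWithin_image_not_countable {X Y : Type*} [TopologicalSpace X]
    [HereditarilyLindelofSpace X] (φ : X → Y) {F : Set X} (hF : ¬ (φ '' F).Countable) :
    ∃ x ∈ F, ∀ t ∈ 𝓝[F] x, ¬ (φ '' t).Countable := by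
  contrapose! hF
  refine (HereditarilyLindelofSpace.isLindelof F).induction_on (p := fun t => (φ '' t).Countable)
    (fun s t hst ht => ht.mono (image_mono hst)) (fun S hS h => ?_) hF
  rw [image_sUnion]
  exact (hS.image _).sUnion (by rintro _ ⟨s, hs, rfl⟩; exact h s hs)

theorem exists_isClosed_small_ediam_disjoint_image {X Y : Type*} [MetricSpace X]
    [HereditarilyLindelofSpace X] [TopologicalSpace Y] [T25Space Y] {φ : X → Y}
    (hφ : Continuous φ) {F : Set X} (hF : IsClosed F) (hFc : ¬ (φ '' F).Countable)
    {ε : ENNReal} (hε : 0 < ε) :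
    ∃ F₀ F₁ : Set X, (IsClosed F₀ ∧ ¬ (φ '' F₀).Countable ∧ F₀ ⊆ F ∧ Metric.ediam F₀ ≤ ε) ∧
      (IsClosed F₁ ∧ ¬ (φ '' F₁).Countable ∧ F₁ ⊆ F ∧ Metric.ediam F₁ ≤ ε) ∧
      Disjoint (φ '' F₀) (φ '' F₁) := by
  obtain ⟨x₀, -, h₀⟩ := exists_forall_mem_nhdsWithin_image_not_countable φ hFc
  have hF' : ¬ (φ '' (F \ φ ⁻¹' {φ x₀})).Countable := fun h => hFc <| by
    refine (h.union (countable_singleton (φ x₀))).mono ?_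
    rintro _ ⟨x, hx, rfl⟩
    by_cases hx' : φ x = φ x₀
    · exact Or.inr hx'
    · exact Or.inl ⟨x, ⟨hx, hx'⟩, rfl⟩
  obtain ⟨x₁, hx₁, h₁⟩ := exists_forall_mem_nhdsWithin_image_not_countable φ hF'
  obtain ⟨U, hxU, hU, V, hxV, hV, hUV⟩ := exists_open_nhds_disjoint_closure (Ne.symm hx₁.2)
  have small : ∀ (x : X) (W : Set Y), IsOpen W → φ x ∈ W →
      (∀ t ∈ 𝓝[F] x, ¬ (φ '' t).Countable) →
      IsClosed (F ∩ φ ⁻¹' closure W ∩ Metric.closedEBall x (ε / 2)) ∧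
      ¬ (φ '' (F ∩ φ ⁻¹' closure W ∩ Metric.closedEBall x (ε / 2))).Countable ∧
      F ∩ φ ⁻¹' closure W ∩ Metric.closedEBall x (ε / 2) ⊆ F ∧
      Metric.ediam (F ∩ φ ⁻¹' closure W ∩ Metric.closedEBall x (ε / 2)) ≤ ε := by
    intro x W hW hxW h
    refine ⟨(hF.inter (isClosed_closure.preimage hφ)).inter Metric.isClosed_closedEBall, h _ ?_,
      inter_subset_left.trans inter_subset_left, ?_⟩
    · refine inter_mem (inter_mem self_mem_nhdsWithin ?_) ?_
      · exact mem_nhdsWithin_of_mem_nhds (mem_of_superset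
          (hφ.continuousAt.preimage_mem_nhds (hW.mem_nhds hxW)) (preimage_mono subset_closure))
      · exact mem_nhdsWithin_of_mem_nhds
          (Metric.closedEBall_mem_nhds x (ENNReal.half_pos hε.ne'))
    · refine (Metric.ediam_mono inter_subset_right).trans (Metric.ediam_closedEBall_le.trans_eq ?_)
      exact ENNReal.mul_div_cancel two_ne_zero ENNReal.ofNat_ne_top
  refine ⟨_, _, small x₀ U hU hxU h₀, small x₁ V hV hxV fun t ht => ?_, ?_⟩
  · exact h₁ t (nhdsWithin_mono _ sdiff_subset ht)
  · refine hUV.mono ?_ ?_ <;> · rintro _ ⟨x, hx, rfl⟩; exact hx.1.2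

/-- A continuous map with uncountable range on a Polish space is injective on a Cantor set. -/
theorem Continuous.exists_nat_bool_comp_injective {X Y : Type*} [TopologicalSpace X]
    [PolishSpace X] [TopologicalSpace Y] [T25Space Y] {φ : X → Y} (hφ : Continuous φ)
    (hc : ¬ (range φ).Countable) :
    ∃ ψ : (ℕ → Bool) → X, Continuous ψ ∧ Function.Injective (φ ∘ ψ) := by
  let := TopologicalSpace.upgradeIsCompletelyMetrizable X
  obtain ⟨u, -, upos', hu⟩ := exists_seq_strictAnti_tendsto' (zero_lt_one' ENNReal)
  have upos := fun n => (upos' n).1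
  let P := Subtype fun F : Set X => IsClosed F ∧ ¬ (φ '' F).Countable
  choose C0 C1 h0 h1 hdisj using
    fun {F : Set X} (hF : IsClosed F) (hFc : ¬ (φ '' F).Countable) {ε : ENNReal} (hε : 0 < ε) =>
    exists_isClosed_small_ediam_disjoint_image hφ hF hFc hε
  let DP : List Bool → P := fun l => by
    induction l with
    | nil => exact ⟨univ, isClosed_univ, by rwa [image_univ]⟩
    | cons a l ih =>
      cases a
      · use C0 ih.property.1 ih.property.2 (upos (l.length + 1))
        exact ⟨(h0 _ _ _).1, (h0 _ _ _).2.1⟩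
      use C1 ih.property.1 ih.property.2 (upos (l.length + 1))
      exact ⟨(h1 _ _ _).1, (h1 _ _ _).2.1⟩
  let D : List Bool → Set X := fun l => (DP l).val
  have hanti : ClosureAntitone D := by
    refine Antitone.closureAntitone ?_ fun l => (DP l).property.1
    intro l a
    cases a
    · exact (h0 _ _ _).2.2.1
    exact (h1 _ _ _).2.2.1
  have hdiam : VanishingDiam D := by
    intro x
    apply tendsto_of_tendsto_of_tendsto_of_le_of_le' tendsto_const_nhds hu
    · simp
    rw [eventually_atTop]
    refine ⟨1, fun m (hm : 1 ≤ m) => ?_⟩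
    rw [Nat.one_le_iff_ne_zero] at hm
    rcases Nat.exists_eq_succ_of_ne_zero hm with ⟨n, rfl⟩
    dsimp
    cases x n
    · convert! (h0 _ _ _).2.2.2
      rw [PiNat.res_length]
    convert! (h1 _ _ _).2.2.2
    rw [PiNat.res_length]
  have hdisj' : CantorScheme.Disjoint fun l => φ '' D l := by
    rintro l (a | a) (b | b) hab <;> try contradiction
    · exact hdisj _ _ _
    exact (hdisj _ _ _).symm
  have hnonempty : ∀ l, (D l).Nonempty := fun l => by
    by_contra h
    exact (DP l).property.2 (by
      simp [not_nonempty_iff_eq_empty.1 h, show (DP l).val = D l from rfl])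
  have hdom : ∀ {x : ℕ → Bool}, x ∈ (inducedMap D).1 := fun {x} => by
    rw [hanti.map_of_vanishingDiam hdiam hnonempty]
    apply mem_univ
  refine ⟨fun x => (inducedMap D).2 ⟨x, hdom⟩, hdiam.map_continuous.comp (by fun_prop), ?_⟩
  intro x y hxy
  have hmem : ∀ (x : ℕ → Bool) (n : ℕ),
      φ ((inducedMap D).2 ⟨x, hdom⟩) ∈ φ '' D (PiNat.res x n) :=
    fun x n => mem_image_of_mem φ (map_mem ⟨x, hdom⟩ n)
  apply PiNat.res_injective
  ext n : 1
  induction n with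
  | zero => simp
  | succ n ih =>
    simp only [PiNat.res_succ, List.cons.injEq]
    refine ⟨?_, ih⟩
    by_contra hne
    have hx := hmem x (n + 1)
    have hy := hmem y (n + 1)
    rw [PiNat.res_succ] at hx hy
    rw [← ih] at hy
    exact disjoint_left.1 (hdisj' (PiNat.res x n) hne) hx (by
      rw [show φ _ = φ _ from hxy]; exact hy)

theorem exists_not_measurableSet_nat_bool : ∃ s : Set (ℕ → Bool), ¬ MeasurableSet s := by
  by_contra! h
  have hcard : Cardinal.mk {t : Set (ℕ → Bool) | MeasurableSet t} ≤ Cardinal.continuum := by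
    obtain ⟨b, hb, hgen⟩ := MeasurableSpace.CountablyGenerated.isCountablyGenerated (α := ℕ → Bool)
    rw [hgen]
    exact MeasurableSpace.cardinal_measurableSet_le_continuum
      (hb.le_aleph0.trans Cardinal.aleph0_le_continuum)
  simp only [h, ofPred_true, Cardinal.mk_univ, Cardinal.mk_set] at hcard
  have : Cardinal.mk (ℕ → Bool) = Cardinal.continuum := by simp
  rw [this] at hcard
  exact (Cardinal.cantor _).not_ge hcard

/-- If all preimages under a map on a standard Borel space are Borel, its range is countable. -/
theorem countable_range_of_forall_measurableSet_preimage {X Z : Type*} [MeasurableSpace X]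
    [StandardBorelSpace X] {h : X → Z} (hh : ∀ A : Set Z, MeasurableSet (h ⁻¹' A)) :
    (range h).Countable := by
  by_contra hc
  choose r hr using fun z : range h => z.2
  let φ : X → ℝ := fun x => embeddingReal X (r ⟨h x, mem_range_self x⟩)
  have hφh : ∀ x y, φ x = φ y → h x = h y := fun x y hxy => by
    have := (measurableEmbedding_embeddingReal X).injective hxy
    exact (hr ⟨h x, mem_range_self x⟩).symm.trans ((congrArg h this).trans (hr _))
  have hφ : Measurable φ := fun s _ => by
    convert! hh {z | ∃ x, h x = z ∧ φ x ∈ s} using 1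
    ext x
    refine ⟨fun hx => ⟨x, rfl, hx⟩, ?_⟩
    rintro ⟨y, hy, hys⟩
    simpa only [φ, mem_preimage, hy] using hys
  have hφc : ¬ (range φ).Countable := fun hcφ => hc <| by
    choose g hg using fun z : range φ => z.2
    have := hcφ.to_subtype
    refine (countable_range fun z => h (g z)).mono ?_
    rintro _ ⟨x, rfl⟩
    exact ⟨⟨φ x, mem_range_self x⟩, hφh _ _ (hg _)⟩
  let I := upgradeStandardBorel X
  obtain ⟨t', ht', hcont, hpol⟩ := hφ.exists_continuous
  obtain ⟨ψ, hψ, hinj⟩ := @Continuous.exists_nat_bool_comp_injective X ℝ t' hpol _ _ φ hcont hφc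
  have hψm : Measurable ψ :=
    @Continuous.measurable _ _ _ _ _ I.toTopologicalSpace _ I.toBorelSpace ψ
      (@continuous_le_rng _ _ ψ _ t' I.toTopologicalSpace ht' hψ)
  obtain ⟨s, hs⟩ := exists_not_measurableSet_nat_bool
  apply hs
  have hsat : s = ψ ⁻¹' (h ⁻¹' ((fun x => h (ψ x)) '' s)) := by
    ext x
    refine ⟨fun hx => ⟨x, hx, rfl⟩, ?_⟩
    rintro ⟨y, hy, hyx⟩
    have : φ (ψ y) = φ (ψ x) := by simp only [φ, show h (ψ y) = h (ψ x) from hyx]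
    rwa [← hinj this]
  rw [hsat]
  exact hψm (hh _)

/-- A Borel map from a standard Borel space to a metric space is strongly measurable, even if
the target is not separable. -/
theorem Measurable.stronglyMeasurable_of_standardBorel {X Y : Type*} [MeasurableSpace X]
    [StandardBorelSpace X] [MetricSpace Y] [MeasurableSpace Y] [BorelSpace Y]
    {f : X → Y} (hf : Measurable f) : StronglyMeasurable f := by
  classical
  refine stronglyMeasurable_iff_measurable_separable.2 ⟨hf, ?_⟩
  suffices h : ∀ ε > 0, ∃ t : Set Y, t.Countable ∧ range f ⊆ ⋃ x ∈ t, Metric.closedEBall x ε by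
    obtain ⟨t, -, ht, hft⟩ := EMetric.subset_countable_closure_of_almost_dense_set _ h
    exact ⟨t, ht, hft⟩
  intro ε hε
  obtain ⟨δ, hδ, hδε⟩ := ENNReal.lt_iff_exists_nnreal_btwn.1 hε
  obtain ⟨D, hD⟩ := zorn_subset {N : Set Y | N ⊆ range f ∧ Metric.IsSeparated δ N}
    fun c hc hchain => ⟨⋃₀ c, ⟨sUnion_subset fun s hs => (hc hs).1,
      (pairwise_sUnion hchain.directedOn).2 fun s hs => (hc hs).2⟩,
      fun s hs => subset_sUnion_of_mem hs⟩
  have hcover := Metric.isCover_iff_subset_iUnion_closedEBall.1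
    (Metric.IsCover.of_maximal_isSeparated hD)
  refine ⟨D, ?_, hcover.trans
    (iUnion₂_mono fun x _ => Metric.closedEBall_subset_closedEBall hδε.le)⟩
  have hclosed : ∀ A ⊆ D, IsClosed A := fun A hA => by
    refine Metric.isClosed_of_pairwise_le_dist (ε := δ) (by exact_mod_cast hδ) fun x hx y hy hxy => ?_
    have : (δ : ENNReal) < EDist.edist x y := hD.prop.2 (hA hx) (hA hy) hxy
    rw [edist_dist, ENNReal.lt_ofReal_iff_toReal_lt ENNReal.coe_ne_top] at this
    exact this.le
  rcases D.eq_empty_or_nonempty with rfl | ⟨d, hd⟩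
  · exact countable_empty
  refine (countable_range_of_forall_measurableSet_preimage
    (h := fun x => if f x ∈ D then f x else d) fun A => ?_).mono fun y hy => ?_
  · have hDm : MeasurableSet (f ⁻¹' D) := hf (hclosed D subset_rfl).measurableSet
    have hAm : MeasurableSet (f ⁻¹' (A ∩ D)) := hf (hclosed _ inter_subset_right).measurableSet
    have : (fun x => if f x ∈ D then f x else d) ⁻¹' A =
        f ⁻¹' (A ∩ D) ∪ ((f ⁻¹' D)ᶜ ∩ {_x | d ∈ A}) := by
      ext x
      by_cases hx : f x ∈ D <;> simp [hx]
    rw [this]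
    exact hAm.union (hDm.compl.inter (.const _))
  · obtain ⟨x, rfl⟩ := hD.prop.1 hy
    exact ⟨x, if_pos hy⟩

end MeasurableDiscrete

section Volterra

open Set

/-- A Grönwall inequality for bounded, not necessarily measurable, solutions of integral
inequalities. -/
theorem norm_le_of_norm_le_add_norm_integral {E : Type*} [NormedAddCommGroup E] [NormedSpace ℝ E]
    {u : ℝ → E} {g : ℝ → ℝ → E} {a b c t₀ T L M : ℝ} (ha : 0 ≤ a) (hb : 0 ≤ b) (hc : 0 ≤ c)
    (hL : T - t₀ ≤ L) (hu : ∀ t ∈ Icc t₀ T, ‖u t‖ ≤ M)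
    (hg : ∀ t ∈ Icc t₀ T, ∀ s ∈ Icc t₀ t, ‖g t s‖ ≤ b * ‖u s‖ + c)
    (h : ∀ t ∈ Icc t₀ T, ‖u t‖ ≤ a + ‖∫ s in t₀..t, g t s‖) :
    ∀ t ∈ Icc t₀ T, ‖u t‖ ≤ 2 * (a + c * L) * Real.exp ((2 * b + 1) * L) := by
  intro t ht
  set r := 2 * b + 1 with hr
  have hr0 : 0 < r := by positivity
  set w : ℝ → ℝ := fun s => ‖u s‖ * Real.exp (-(r * (s - t₀))) with hw
  set m := sSup (w '' Icc t₀ T) with hm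
  have hbdd : BddAbove (w '' Icc t₀ T) := by
    refine ⟨M, ?_⟩
    rintro _ ⟨s, hs, rfl⟩
    have h1 : Real.exp (-(r * (s - t₀))) ≤ 1 := Real.exp_le_one_iff.2 (by
      have := mul_nonneg hr0.le (sub_nonneg.2 hs.1); linarith)
    exact (mul_le_of_le_one_right (norm_nonneg _) h1).trans (hu s hs)
  have hle : ∀ s ∈ Icc t₀ T, w s ≤ m := fun s hs => le_csSup hbdd ⟨s, hs, rfl⟩
  have hcancel : ∀ s, Real.exp (-(r * (s - t₀))) * Real.exp (r * (s - t₀)) = 1 := fun s => by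
    rw [← Real.exp_add, neg_add_cancel, Real.exp_zero]
  have hule : ∀ s ∈ Icc t₀ T, ‖u s‖ ≤ m * Real.exp (r * (s - t₀)) := fun s hs => by
    have := mul_le_mul_of_nonneg_right (hle s hs) (Real.exp_pos (r * (s - t₀))).le
    rwa [hw, mul_assoc, hcancel, mul_one] at this
  have hm0 : 0 ≤ m := (by positivity : 0 ≤ w t).trans (hle t ht)
  have hw_le : ∀ s ∈ Icc t₀ T, w s ≤ a + c * L + m / 2 := by
    intro s hs
    have hderiv : ∀ x ∈ uIcc t₀ s, HasDerivAt
        (fun x => b * m * Real.exp (r * (x - t₀)) / r + c * x)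
        (b * m * Real.exp (r * (x - t₀)) + c) x := fun x _ => by
      have h1 : HasDerivAt (fun x => r * (x - t₀)) r x := by
        simpa using ((hasDerivAt_id x).sub_const t₀).const_mul r
      convert! ((h1.exp.const_mul (b * m)).div_const r).add ((hasDerivAt_id x).const_mul c) using 1
      field_simp
    have hint : IntervalIntegrable (fun x => b * m * Real.exp (r * (x - t₀)) + c) volume t₀ s :=
      (by fun_prop : Continuous fun x => b * m * Real.exp (r * (x - t₀)) + c).intervalIntegrable _ _
    have hI := intervalIntegral.norm_integral_le_of_norm_le hs.1
      (Filter.Eventually.of_forall fun x hx => (hg s hs x ⟨hx.1.le, hx.2⟩).trans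
        (by
          have := mul_le_mul_of_nonneg_left (hule x ⟨hx.1.le, hx.2.trans hs.2⟩) hb
          linarith : _ ≤ b * m * Real.exp (r * (x - t₀)) + c)) hint
    rw [intervalIntegral.integral_eq_sub_of_hasDerivAt hderiv hint] at hI
    have h1 : b * m * Real.exp (r * (s - t₀)) / r ≤ m / 2 * Real.exp (r * (s - t₀)) := by
      rw [div_le_iff₀ hr0]
      have := mul_nonneg hm0 (Real.exp_pos (r * (s - t₀))).le
      nlinarith
    have h2 : 0 ≤ b * m * Real.exp (r * (t₀ - t₀)) / r := by positivity
    have h3 : c * s - c * t₀ ≤ c * L := by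
      rw [← mul_sub]; exact mul_le_mul_of_nonneg_left (by linarith [hs.2]) hc
    have hus : ‖u s‖ ≤ a + c * L + m / 2 * Real.exp (r * (s - t₀)) := by
      linarith [h s hs]
    have hL0 : 0 ≤ L := by linarith [hs.1, hs.2]
    have h4 : Real.exp (-(r * (s - t₀))) ≤ 1 := Real.exp_le_one_iff.2 (by
      have := mul_nonneg hr0.le (sub_nonneg.2 hs.1); linarith)
    calc w s ≤ (a + c * L + m / 2 * Real.exp (r * (s - t₀))) * Real.exp (-(r * (s - t₀))) :=
          mul_le_mul_of_nonneg_right hus (Real.exp_pos _).le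
      _ = (a + c * L) * Real.exp (-(r * (s - t₀))) + m / 2 := by
          linear_combination (m / 2) * hcancel s
      _ ≤ a + c * L + m / 2 := by
          have := mul_le_of_le_one_right (by positivity : 0 ≤ a + c * L) h4
          linarith
  have hmle : m ≤ a + c * L + m / 2 :=
    csSup_le ⟨_, t, ht, rfl⟩ (by rintro _ ⟨s, hs, rfl⟩; exact hw_le s hs)
  have hexp : Real.exp (r * (t - t₀)) ≤ Real.exp (r * L) :=
    Real.exp_le_exp.2 (mul_le_mul_of_nonneg_left (by linarith [ht.2]) hr0.le)
  exact (hule t ht).trans (mul_le_mul (by linarith) hexp (Real.exp_pos _).le (by linarith))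

end Volterra

section MildSolution

open Set

theorem norm_sub_sub_le_of_norm_second_fderiv_le {E F : Type*} [NormedAddCommGroup E]
    [NormedSpace ℝ E] [NormedAddCommGroup F] [NormedSpace ℝ F] {f : E → F} {f' : E → E →L[ℝ] F}
    {f'' : E → E →L[ℝ] E →L[ℝ] F} {M : ℝ} (hf : ∀ x, HasFDerivAt f (f' x) x)
    (hf' : ∀ x, HasFDerivAt f' (f'' x) x) (hM : ∀ x, ‖f'' x‖ ≤ M) (x y : E) :
    ‖f y - f x - f' x (y - x)‖ ≤ M * ‖y - x‖ ^ 2 := by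
  have hM0 : 0 ≤ M := (f'' x).opNorm_nonneg.trans (hM x)
  have hlip : ∀ w, ‖f' w - f' x‖ ≤ M * ‖w - x‖ := fun w =>
    convex_univ.norm_image_sub_le_of_norm_hasFDerivWithin_le
      (fun v _ => (hf' v).hasFDerivWithinAt) (fun v _ => hM v) (mem_univ x) (mem_univ w)
  have := (convex_closedBall x ‖y - x‖).norm_image_sub_le_of_norm_hasFDerivWithin_le'
    (φ := f' x) (C := M * ‖y - x‖) (fun w _ => (hf w).hasFDerivWithinAt)
    (fun w hw => (hlip w).trans
      (mul_le_mul_of_nonneg_left (by simpa [dist_eq_norm] using hw) hM0))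
    (Metric.mem_closedBall_self (norm_nonneg _))
    (by simp [dist_eq_norm] : y ∈ Metric.closedBall x ‖y - x‖)
  rwa [mul_assoc, ← sq] at this

/-- Bounded functions which are Borel on a compact interval are integrable, even if the target is
not separable. -/
theorem intervalIntegrable_of_measurable_of_bounded {E : Type*} [NormedAddCommGroup E]
    [MeasurableSpace E] [BorelSpace E] {f : ℝ → E} {a b M : ℝ} (hab : a ≤ b)
    (hf : Measurable fun s : Icc a b => f s) (hM : ∀ s ∈ Icc a b, ‖f s‖ ≤ M) :
    IntervalIntegrable f volume a b := by
  have := (measurableSet_Icc (a := a) (b := b)).standardBorel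
  have hmeas : AEStronglyMeasurable f (volume.restrict (Icc a b)) := by
    rw [← map_comap_subtype_coe measurableSet_Icc,
      (MeasurableEmbedding.subtype_coe measurableSet_Icc).aestronglyMeasurable_map_iff]
    exact hf.stronglyMeasurable_of_standardBorel.aestronglyMeasurable
  rw [intervalIntegrable_iff_integrableOn_Icc_of_le hab]
  refine Integrable.of_bound hmeas M ?_
  exact (ae_restrict_iff' measurableSet_Icc).2 (Filter.Eventually.of_forall hM)

/-- The integrand of the mild formulation is integrable. -/
theorem intervalIntegrable_comp_clm {E : Type*} [NormedAddCommGroup E] [NormedSpace ℝ E]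
    [MeasurableSpace E] [BorelSpace E] {S : ℝ → E →L[ℝ] E} {f : ℝ → E} {t₀ t T C M : ℝ}
    (hS : Measurable fun p : ℝ × E => S p.1 p.2) (hSC : ∀ t ∈ Icc (0 : ℝ) T, ‖S t‖ ≤ C)
    (ht₀ : 0 ≤ t₀) (ht : t ∈ Icc t₀ T) (hf : Measurable fun s : Icc t₀ T => f s)
    (hM : ∀ s ∈ Icc t₀ T, ‖f s‖ ≤ M) :
    IntervalIntegrable (fun s => S (t - s) (f s)) volume t₀ t := by
  refine intervalIntegrable_of_measurable_of_bounded (M := C * M) ht.1 ?_ fun s hs => ?_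
  · have hfm : Measurable fun s : Icc t₀ t => f s :=
      hf.comp (measurable_inclusion (Icc_subset_Icc_right ht.2))
    exact hS.comp ((measurable_subtype_coe.const_sub t).prodMk hfm)
  · have hC := hSC (t - s) ⟨by linarith [hs.2], by linarith [hs.1, ht.2]⟩
    exact (S (t - s)).le_of_opNorm_le_of_le hC (hM s ⟨hs.1, hs.2.trans ht.2⟩)

theorem measurable_clm_apply_of_standardBorel {X E F G : Type*} [MeasurableSpace X]
    [StandardBorelSpace X] [NormedAddCommGroup E] [NormedSpace ℝ E] [NormedAddCommGroup F]
    [NormedSpace ℝ F] [NormedAddCommGroup G] [NormedSpace ℝ G] [MeasurableSpace G] [BorelSpace G]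
    {A : X → F →L[ℝ] G} {D : X → E →L[ℝ] F} (hA : Measurable A) (hD : Measurable D) (h : E) :
    Measurable fun x => A x (D x h) := by
  have : BorelSpace (F →L[ℝ] G) := ⟨rfl⟩
  have : BorelSpace (E →L[ℝ] F) := ⟨rfl⟩
  have hDh := (ContinuousLinearMap.apply ℝ F h).continuous.comp_stronglyMeasurable
    hD.stronglyMeasurable_of_standardBorel
  exact (isBoundedBilinearMap_apply.continuous.comp_stronglyMeasurable
    (hA.stronglyMeasurable_of_standardBorel.prodMk hDh)).measurable

end MildSolution

/-- There is a constant `C′` depending only on `C_A`, `K_B`, `M_B`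
and `T` with `‖Y^{t₀,y+k}(t) − Y^{t₀,y}(t) − ξ^{t₀,y}(t)k‖ ≤ C′‖k‖²`; consequently
`y ↦ Y^{t₀,y}(t)` is Fréchet differentiable with derivative `ξ^{t₀,y}(t)`. -/
theorem mild_solution_fderiv_initial_datum (C_A K_B M_B T : ℝ) :
    ∃ C' : ℝ, ∀ (E : Type u) [NormedAddCommGroup E] [NormedSpace ℝ E] [CompleteSpace E]
      [MeasurableSpace E] [BorelSpace E],
      ∀ (t₀ : ℝ), 0 < T → t₀ ∈ Set.Ico (0:ℝ) T →
      ∀ S : ℝ → E →L[ℝ] E,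
        S 0 = ContinuousLinearMap.id ℝ E →
        (∀ s t : ℝ, 0 ≤ s → 0 ≤ t → s + t ≤ T → (S t).comp (S s) = S (s + t)) →
        (∀ t ∈ Set.Icc (0:ℝ) T, ‖S t‖ ≤ C_A) →
        (Measurable fun p : ℝ × E => S p.1 p.2) →
      ∀ (B : ℝ → E → E) (DB : ℝ → E → E →L[ℝ] E)
        (D2B : ℝ → E → E →L[ℝ] E →L[ℝ] E) (Bsup : ℝ),
        Measurable (Function.uncurry B) →
        (Measurable fun p : ℝ × E => DB p.1 p.2) →
        (Measurable fun p : ℝ × E => D2B p.1 p.2) →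
        (∀ t x, ‖B t x‖ ≤ Bsup) →
        (∀ t x, HasFDerivAt (B t) (DB t x) x) →
        (∀ t x, ‖DB t x‖ ≤ K_B) →
        (∀ t x, HasFDerivAt (fun w => DB t w) (D2B t x) x) →
        (∀ t x, ‖D2B t x‖ ≤ M_B) →
      ∀ z : ℝ → E, BddMeasOn z t₀ T →
      ∀ (Y : E → ℝ → E) (ξ : E → ℝ → E →L[ℝ] E),
        (∀ y : E, BddMeasOn (Y y) t₀ T ∧ IsMildSolution S B t₀ T y z (Y y)) →
        (∀ y : E, BddMeasOn (ξ y) t₀ T ∧ IsFirstVariation S DB t₀ T (Y y) (ξ y)) →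
        (∀ (y k : E), ∀ t ∈ Set.Icc t₀ T,
          ‖Y (y + k) t - Y y t - ξ y t k‖ ≤ C' * ‖k‖ ^ 2) ∧
        (∀ t ∈ Set.Icc t₀ T, ∀ y : E,
          HasFDerivAt (fun w => Y w t) (ξ y t) y) := by
  set L := 2 * C_A * Real.exp ((2 * (C_A * K_B) + 1) * T) with hL
  refine ⟨2 * (C_A * M_B * L ^ 2 * T) * Real.exp ((2 * (C_A * K_B) + 1) * T), ?_⟩
  intro E _ _ _ _ _ t₀ hT ht₀ S _ _ hSC hSm B DB D2B Bsup hBm hDBm _ hB hBD hDBK hDBD hD2B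
    z _ Y ξ hY hξ
  have hC0 : 0 ≤ C_A := (norm_nonneg _).trans (hSC 0 ⟨le_rfl, hT.le⟩)
  have hK0 : 0 ≤ K_B := (norm_nonneg _).trans (hDBK 0 0)
  have hM0 : 0 ≤ M_B := (D2B 0 0).opNorm_nonneg.trans (hD2B 0 0)
  have hTt : T - t₀ ≤ T := by linarith [ht₀.1]
  have hSle : ∀ t ∈ Set.Icc t₀ T, ∀ s ∈ Set.Icc t₀ t, ‖S (t - s)‖ ≤ C_A := fun t ht s hs =>
    hSC _ ⟨by linarith [hs.2], by linarith [hs.1, ht.2, ht₀.1]⟩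
  have hBlip : ∀ s x y, ‖B s y - B s x‖ ≤ K_B * ‖y - x‖ := fun s x y =>
    convex_univ.norm_image_sub_le_of_norm_hasFDerivWithin_le
      (fun v _ => (hBD s v).hasFDerivWithinAt) (fun v _ => hDBK s v)
      (Set.mem_univ x) (Set.mem_univ y)
  have hBint : ∀ y, ∀ t ∈ Set.Icc t₀ T,
      IntervalIntegrable (fun s => S (t - s) (B s (Y y s))) volume t₀ t := fun y t ht =>
    intervalIntegrable_comp_clm hSm hSC ht₀.1 ht
      (hBm.comp (measurable_subtype_coe.prodMk (hY y).1.1)) fun s _ => hB s _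
  have hdiff : ∀ y k, ∀ t ∈ Set.Icc t₀ T, Y (y + k) t - Y y t =
      S (t - t₀) k + ∫ s in t₀..t, S (t - s) (B s (Y (y + k) s) - B s (Y y s)) := by
    intro y k t ht
    rw [(hY (y + k)).2 t ht, (hY y).2 t ht]
    simp only [map_sub, map_add]
    rw [intervalIntegral.integral_sub (hBint _ t ht) (hBint _ t ht)]
    abel
  have hlip : ∀ y k, ∀ t ∈ Set.Icc t₀ T, ‖Y (y + k) t - Y y t‖ ≤ L * ‖k‖ := by
    intro y k t ht
    obtain ⟨M₀, h₀⟩ := (hY y).1.2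
    obtain ⟨M₁, h₁⟩ := (hY (y + k)).1.2
    have := norm_le_of_norm_le_add_norm_integral (u := fun t => Y (y + k) t - Y y t)
      (g := fun t s => S (t - s) (B s (Y (y + k) s) - B s (Y y s))) (a := C_A * ‖k‖)
      (b := C_A * K_B) (c := 0) (L := T) (M := M₁ + M₀) (by positivity) (by positivity) le_rfl hTt
      (fun s hs => (norm_sub_le _ _).trans (add_le_add (h₁ s hs) (h₀ s hs)))
      (fun s hs r hr => by
        rw [add_zero, mul_assoc]
        exact (S (s - r)).le_of_opNorm_le_of_le (hSle s hs r hr) (hBlip _ _ _))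
      (fun s hs => by
        rw [hdiff y k s hs]
        exact (norm_add_le _ _).trans (add_le_add_left
          ((S (s - t₀)).le_of_opNorm_le (hSle s hs t₀ ⟨le_rfl, hs.1⟩) k) _)) t ht
    rw [hL]
    linarith
  have hrem : ∀ y k, ∀ t ∈ Set.Icc t₀ T, Y (y + k) t - Y y t - ξ y t k =
      ∫ s in t₀..t, S (t - s) (B s (Y (y + k) s) - B s (Y y s) - DB s (Y y s) (ξ y s k)) := by
    intro y k t ht
    have : StandardBorelSpace (Set.Icc t₀ T) := measurableSet_Icc.standardBorel
    obtain ⟨Mξ, hMξ⟩ := (hξ y).1.2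
    have hξint : IntervalIntegrable (fun s => S (t - s) (DB s (Y y s) (ξ y s k))) volume t₀ t :=
      intervalIntegrable_comp_clm hSm hSC ht₀.1 ht
        (measurable_clm_apply_of_standardBorel
          (hDBm.comp (measurable_subtype_coe.prodMk (hY y).1.1)) (hξ y).1.1 k)
        fun s hs => (DB s (Y y s)).le_of_opNorm_le_of_le (hDBK _ _)
          ((ξ y s).le_of_opNorm_le (hMξ s hs) k)
    rw [hdiff y k t ht, (hξ y).2 t ht k]
    simp only [map_sub]
    rw [intervalIntegral.integral_sub ((hBint _ t ht).sub (hBint _ t ht)) hξint]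
    abel
  have hquad : ∀ y k, ∀ t ∈ Set.Icc t₀ T, ‖Y (y + k) t - Y y t - ξ y t k‖ ≤
      2 * (C_A * M_B * L ^ 2 * T) * Real.exp ((2 * (C_A * K_B) + 1) * T) * ‖k‖ ^ 2 := by
    intro y k t ht
    obtain ⟨Mξ, hMξ⟩ := (hξ y).1.2
    have := norm_le_of_norm_le_add_norm_integral (u := fun t => Y (y + k) t - Y y t - ξ y t k)
      (g := fun t s => S (t - s) (B s (Y (y + k) s) - B s (Y y s) - DB s (Y y s) (ξ y s k)))
      (a := 0) (b := C_A * K_B) (c := C_A * (M_B * (L * ‖k‖) ^ 2)) (L := T)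
      (M := L * ‖k‖ + Mξ * ‖k‖) le_rfl (by positivity) (by positivity) hTt
      (fun s hs => (norm_sub_le _ _).trans
        (add_le_add (hlip y k s hs) ((ξ y s).le_of_opNorm_le (hMξ s hs) k)))
      (fun s hs r hr => by
        have htaylor := norm_sub_sub_le_of_norm_second_fderiv_le (hBD r) (hDBD r) (hD2B r)
          (Y y r) (Y (y + k) r)
        have hsq : M_B * ‖Y (y + k) r - Y y r‖ ^ 2 ≤ M_B * (L * ‖k‖) ^ 2 :=
          mul_le_mul_of_nonneg_left
            (pow_le_pow_left₀ (norm_nonneg _) (hlip y k r ⟨hr.1, hr.2.trans hs.2⟩) 2) hM0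
        have hDB := (DB r (Y y r)).le_of_opNorm_le (hDBK r (Y y r))
          (Y (y + k) r - Y y r - ξ y r k)
        have hsplit : B r (Y (y + k) r) - B r (Y y r) - DB r (Y y r) (ξ y r k) =
            DB r (Y y r) (Y (y + k) r - Y y r - ξ y r k) + (B r (Y (y + k) r) - B r (Y y r) -
              DB r (Y y r) (Y (y + k) r - Y y r)) := by
          rw [map_sub _ _ (ξ y r k)]
          abel
        rw [mul_assoc, ← mul_add]
        refine (S (s - r)).le_of_opNorm_le_of_le (hSle s hs r hr) ?_
        rw [hsplit]
        exact (norm_add_le _ _).trans (add_le_add hDB (htaylor.trans hsq)))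
      (fun s hs => by rw [hrem y k s hs, zero_add]) t ht
    linarith
  refine ⟨hquad, fun t ht y => hasFDerivAt_iff_isLittleO_nhds_zero.2 ?_⟩
  refine Asymptotics.IsBigO.trans_isLittleO (g := fun k : E => ‖k‖ ^ 2)
    (.of_bound (2 * (C_A * M_B * L ^ 2 * T) * Real.exp ((2 * (C_A * K_B) + 1) * T))
      (.of_forall fun k => ?_)) (Asymptotics.isLittleO_norm_pow_id one_lt_two)
  rw [norm_pow, norm_norm]
  exact hquad y k t ht
end

section
/- Let B and (B_n)_{n∈ℕ} all be measurable, bounded by the same constant ‖B‖_∞ and uniformly Lipschitz in their second argument with the same constant K_B, and let Y and Y_n denote the mild solutions with the same data (y,z) and drifts B and B_n respectively. If for every s ∈ [t₀,T] one has B_n(s, Y(s)) → B(s, Y(s)) in E as n → ∞, then sup_{t∈[t₀,T]} ‖Y_n(t) − Y(t)‖ → 0 as n → ∞. -/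
open MeasureTheory Filter

/-- A countably generated σ-algebra has at most continuum many measurable sets. -/
theorem mk_measurableSet_le_continuum (X : Type*) [m : MeasurableSpace X]
    [h : MeasurableSpace.CountablyGenerated X] :
    Cardinal.mk {t : Set X // MeasurableSet t} ≤ Cardinal.continuum := by
  obtain ⟨b, hb, rfl⟩ := h.isCountablyGenerated
  exact MeasurableSpace.cardinal_measurableSet_le_continuum
    ((Cardinal.mk_le_aleph0_iff.2 hb.to_subtype).trans Cardinal.aleph0_le_continuum)

/-- A continuous map with null fibres, for a nonzero finite measure on a Polish space, has a range
of cardinality at least the continuum. -/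
theorem Continuous.exists_nat_bool_injection_of_measure_fiber_eq_zero {X Y : Type*}
    [TopologicalSpace X] [PolishSpace X] [MeasurableSpace X] [BorelSpace X] [TopologicalSpace Y]
    [PolishSpace Y] {μ : Measure X} [IsFiniteMeasure μ] (hμ : μ ≠ 0) {r : X → Y}
    (hr : Continuous r) (hnull : ∀ y, μ (r ⁻¹' {y}) = 0) :
    ∃ g : (ℕ → Bool) → Y, Set.range g ⊆ Set.range r ∧ Function.Injective g := by
  have hpos : 0 < μ Set.univ := by
    rw [pos_iff_ne_zero]
    exact fun h => hμ (Measure.measure_univ_eq_zero.1 h)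
  obtain ⟨K, -, hKc, hK⟩ := MeasurableSet.univ.exists_lt_isCompact (μ := μ) hpos
  have hunc : ¬ (r '' K).Countable := by
    intro hc
    refine hK.ne' (measure_mono_null (t := ⋃ y ∈ r '' K, r ⁻¹' {y}) (fun x hx => ?_)
      ((measure_biUnion_null_iff hc).2 fun y _ => hnull y))
    simp only [Set.mem_iUnion]
    exact ⟨r x, ⟨x, hx, rfl⟩, rfl⟩
  obtain ⟨g, hgK, -, hg⟩ :=
    (hKc.image hr).isClosed.exists_nat_bool_injection_of_not_countable hunc
  exact ⟨g, hgK.trans (Set.image_subset_range r K), hg⟩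

/-- A finite measure on a Polish space vanishes if all unions of fibres of some map are
measurable and all fibres are null. -/
theorem measure_eq_zero_of_forall_measurableSet_preimage {X ι : Type*} [tX : TopologicalSpace X]
    [hX : PolishSpace X] [MeasurableSpace X] [bX : BorelSpace X] (μ : Measure X)
    [IsFiniteMeasure μ] {q : X → ι} (hq : ∀ W : Set ι, MeasurableSet (q ⁻¹' W))
    (hnull : ∀ i, μ (q ⁻¹' {i}) = 0) : μ = 0 := by
  let r : X → X := fun x => Set.rangeSplitting q ⟨q x, x, rfl⟩
  have hqr : ∀ x, q (r x) = q x := fun x => Set.apply_rangeSplitting q _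
  have hr : ∀ W : Set X, MeasurableSet (r ⁻¹' W) := by
    intro W
    have : r ⁻¹' W = q ⁻¹' {i | ∃ h : i ∈ Set.range q, Set.rangeSplitting q ⟨i, h⟩ ∈ W} := by
      ext x
      simp [r]
    exact this ▸ hq _
  have hrnull : ∀ x, μ (r ⁻¹' {x}) = 0 := fun x =>
    measure_mono_null (fun y (hy : r y = x) => show q y = q x by rw [← hy, hqr]) (hnull (q x))
  obtain ⟨t', ht', hcont, hpol⟩ := Measurable.exists_continuous (f := r) fun s _ => hr s
  have hborel : @BorelSpace X t' _ := by
    refine @BorelSpace.mk X t' _ ?_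
    rw [borel_eq_borel_of_le hpol hX ht']
    exact bX.measurable_eq
  by_contra hμ
  obtain ⟨g, hgr, hg⟩ :=
    @Continuous.exists_nat_bool_injection_of_measure_fiber_eq_zero X X t' hpol _ hborel tX hX μ _
      hμ r hcont hrnull
  let F : Set (ℕ → Bool) → {t : Set X // MeasurableSet t} := fun W => ⟨r ⁻¹' (g '' W), hr _⟩
  have hF : Function.Injective F := by
    intro V W hVW
    have hsub : ∀ V : Set (ℕ → Bool), g '' V ⊆ Set.range r := fun V =>
      (Set.image_subset_range g V).trans hgr
    refine hg.image_injective ?_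
    have := congrArg (fun s => r '' s.1) hVW
    simpa only [F, Set.image_preimage_eq_of_subset (hsub _)] using this
  have hle := (Cardinal.lift_mk_le_lift_mk_of_injective hF).trans
    (Cardinal.lift_le.2 (mk_measurableSet_le_continuum X))
  simp only [Cardinal.mk_set, Cardinal.mk_pi, Cardinal.mk_bool, Cardinal.prod_const,
    Cardinal.mk_nat, Cardinal.lift_id, Cardinal.lift_power, Cardinal.lift_two,
    Cardinal.two_power_aleph0, Cardinal.lift_continuum] at hle
  exact (Cardinal.cantor _).not_ge hle

/-- If all unions of a disjoint family of null sets are measurable, the whole union is null. -/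
theorem measure_iUnion_eq_zero_of_forall_measurableSet_biUnion {X ι : Type*} [TopologicalSpace X]
    [PolishSpace X] [MeasurableSpace X] [BorelSpace X] (μ : Measure X) [IsFiniteMeasure μ]
    {A : ι → Set X} (hdisj : Pairwise (Function.onFun Disjoint A))
    (hA : ∀ W : Set ι, MeasurableSet (⋃ i ∈ W, A i)) (hnull : ∀ i, μ (A i) = 0) :
    μ (⋃ i, A i) = 0 := by
  classical
  have hU : MeasurableSet (⋃ i, A i) := by simpa using hA Set.univ
  let q : X → Option ι := fun x => if h : ∃ i, x ∈ A i then some h.choose else none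
  have hsome : ∀ x i, q x = some i ↔ x ∈ A i := by
    intro x i
    by_cases h : ∃ i, x ∈ A i
    · simp only [q, dif_pos h, Option.some.injEq]
      refine ⟨fun hi => hi ▸ h.choose_spec, fun hi => ?_⟩
      by_contra hne
      exact Set.disjoint_left.1 (hdisj hne) h.choose_spec hi
    · simp only [q, dif_neg h, reduceCtorEq, false_iff]
      exact fun hi => h ⟨i, hi⟩
  have hnone : ∀ x, q x = none ↔ x ∉ ⋃ i, A i := by
    intro x
    simp only [Option.eq_none_iff_forall_not_mem, Option.mem_def, hsome, Set.mem_iUnion, not_exists]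
  rw [← Measure.restrict_eq_zero]
  refine measure_eq_zero_of_forall_measurableSet_preimage _ (q := q) (fun W => ?_) fun o => ?_
  · have : q ⁻¹' W = (⋃ i ∈ some ⁻¹' W, A i) ∪ ({x | none ∈ W} ∩ (⋃ i, A i)ᶜ) := by
      ext x
      rcases hqx : q x with _ | i
      · have hx := (hnone x).1 hqx
        have hx' : ∀ i, x ∉ A i := by simpa using hx
        simp [hqx, hx']
      · have hx := (hsome x i).1 hqx
        have hx' : ∀ j, x ∈ A j ↔ i = j := fun j => by rw [← hsome, hqx, Option.some.injEq]
        simp [hqx, hx']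
    rw [this]
    exact (hA _).union ((MeasurableSet.const _).inter hU.compl)
  · rcases o with _ | i
    · have : q ⁻¹' {none} = (⋃ i, A i)ᶜ := Set.ext fun x => hnone x
      rw [this, Measure.restrict_apply hU.compl, Set.compl_inter_self, measure_empty]
    · have : q ⁻¹' {some i} = A i := Set.ext fun x => hsome x i
      rw [this]
      exact le_antisymm ((Measure.restrict_apply_le _ _).trans (hnull i).le) zero_le

/-- The cover of a metric space by all balls of a fixed radius has a σ-disjoint open refinement. -/
theorem exists_sigma_disjoint_open_refinement_ball (E : Type*) [PseudoMetricSpace E] {ε : ℝ}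
    (hε : 0 < ε) :
    ∃ U : ℕ → E → Set E, (∀ n c, IsOpen (U n c)) ∧
      (∀ n, Pairwise (Function.onFun Disjoint (U n))) ∧ (∀ n c, U n c ⊆ Metric.ball c ε) ∧
      ∀ x, ∃ n c, x ∈ U n c := by
  obtain ⟨_, hwf⟩ := exists_wellFoundedLT E
  have hne : ∀ x : E, {c | x ∈ Metric.ball c ε}.Nonempty := fun x => ⟨x, Metric.mem_ball_self hε⟩
  let p : E → E := fun x => hwf.wf.min {c | x ∈ Metric.ball c ε} (hne x)
  have hp : ∀ x, x ∈ Metric.ball (p x) ε := fun x => hwf.wf.min_mem _ (hne x)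
  let δ : ℕ → ℝ := fun n => 1 / (n + 1)
  have hδ : ∀ n, 0 < δ n := fun n => Nat.one_div_pos_of_nat
  let V : ℕ → E → Set E := fun n c => {x | p x = c ∧ Metric.ball x (δ n) ⊆ Metric.ball c ε}
  have hsep : ∀ n c c' x x', c < c' → x ∈ V n c → x' ∈ V n c' → δ n ≤ dist x' x := by
    intro n c c' x x' hcc hx hx'
    by_contra! hlt
    exact hwf.wf.not_lt_min {c | x' ∈ Metric.ball c ε} (hx.2 hlt)
      (show c < p x' by rwa [hx'.1])
  refine ⟨fun n c => ⋃ x ∈ V n c, Metric.ball x (δ n / 2), fun n c =>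
    isOpen_biUnion fun _ _ => Metric.isOpen_ball, fun n c c' hne => ?_, fun n c => ?_, fun x => ?_⟩
  · refine Set.disjoint_left.2 fun z hz hz' => ?_
    simp only [Set.mem_iUnion, Metric.mem_ball, exists_prop] at hz hz'
    obtain ⟨x, hx, hzx⟩ := hz
    obtain ⟨x', hx', hzx'⟩ := hz'
    have h₁ := dist_triangle_left x x' z
    have h₂ := dist_comm x x'
    rcases hne.lt_or_gt with h | h
    · have := hsep n c c' x x' h hx hx'
      linarith
    · have := hsep n c' c x' x h hx' hx
      linarith
  · refine Set.iUnion₂_subset fun x hx => (Metric.ball_subset_ball ?_).trans hx.2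
    linarith [hδ n]
  · obtain ⟨n, hn⟩ := exists_nat_one_div_lt (sub_pos.2 (Metric.mem_ball.1 (hp x)))
    refine ⟨n, p x, Set.mem_biUnion (x := x) ⟨rfl, Metric.ball_subset_ball' ?_⟩
      (Metric.mem_ball_self (half_pos (hδ n)))⟩
    simp only [δ]
    linarith

/-- A Borel map from a Polish space with a finite measure to a metric space, not assumed
separable, is almost everywhere strongly measurable. -/
theorem Measurable.aestronglyMeasurable_of_polishSpace {X E : Type*} [TopologicalSpace X]
    [PolishSpace X] [MeasurableSpace X] [BorelSpace X] [PseudoMetricSpace E] [MeasurableSpace E]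
    [BorelSpace E] {μ : Measure X} [IsFiniteMeasure μ] {f : X → E} (hf : Measurable f) :
    AEStronglyMeasurable f μ := by
  have key : ∀ ε : ℝ, 0 < ε →
      ∃ C : Set E, C.Countable ∧ ∀ᵐ x ∂μ, ∃ c ∈ C, f x ∈ Metric.ball c ε := by
    intro ε hε
    obtain ⟨U, hopen, hdisj, hball, hcover⟩ := exists_sigma_disjoint_open_refinement_ball E hε
    let C : ℕ → Set E := fun n => {c | 0 < μ (f ⁻¹' U n c)}
    have hC : ∀ n, (C n).Countable := fun n =>
      Measure.countable_meas_pos_of_disjoint_iUnion (fun c => hf (hopen n c).measurableSet)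
        fun c c' hne => (hdisj n hne).preimage f
    have hnull : ∀ n, μ (⋃ c : ↥(C n)ᶜ, f ⁻¹' U n c) = 0 := by
      intro n
      refine measure_iUnion_eq_zero_of_forall_measurableSet_biUnion μ
        (fun c c' hne => (hdisj n (Subtype.coe_injective.ne hne)).preimage f) (fun W => ?_)
        fun c => nonpos_iff_eq_zero.1 (not_lt.1 c.2)
      rw [← Set.preimage_iUnion₂]
      exact hf (isOpen_iUnion fun c => isOpen_iUnion fun _ => hopen n (Subtype.val c)).measurableSet
    refine ⟨⋃ n, C n, Set.countable_iUnion hC, ?_⟩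
    filter_upwards [ae_all_iff.2 fun n => measure_eq_zero_iff_ae_notMem.1 (hnull n)] with x hx
    obtain ⟨n, c, hc⟩ := hcover (f x)
    refine ⟨c, Set.mem_iUnion.2 ⟨n, ?_⟩, hball n c hc⟩
    by_contra hcC
    exact hx n (Set.mem_iUnion.2 ⟨⟨c, hcC⟩, hc⟩)
  choose C hC hfC using fun n : ℕ => key (1 / (n + 1)) Nat.one_div_pos_of_nat
  refine aestronglyMeasurable_iff_aemeasurable_separable.2 ⟨hf.aemeasurable,
    closure (⋃ n, C n), (Set.countable_iUnion hC).isSeparable.closure, ?_⟩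
  filter_upwards [ae_all_iff.2 hfC] with x hx
  refine Metric.mem_closure_iff.2 fun ε hε => ?_
  obtain ⟨n, hn⟩ := exists_nat_one_div_lt hε
  obtain ⟨c, hc, hxc⟩ := hx n
  exact ⟨c, Set.mem_iUnion.2 ⟨n, hc⟩, (Metric.mem_ball.1 hxc).trans hn⟩

/-- A Grönwall inequality in integral form for bounded functions without any regularity: the
integral inequality is only required for continuous majorants. -/
theorem le_two_mul_exp_of_forall_continuous_majorant {d : ℝ → ℝ} {a L M t₀ T : ℝ} (ha : 0 ≤ a)
    (hL : 0 ≤ L) (hM : ∀ t ∈ Set.Icc t₀ T, d t ≤ M)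
    (h : ∀ g : ℝ → ℝ, Continuous g → (∀ s ∈ Set.Icc t₀ T, d s ≤ g s) →
      ∀ t ∈ Set.Icc t₀ T, d t ≤ a + L * ∫ s in t₀..t, g s) :
    ∀ t ∈ Set.Icc t₀ T, d t ≤ 2 * a * Real.exp ((2 * L + 1) * (t - t₀)) := by
  set k := 2 * L + 1 with hk
  have hkpos : 0 < k := by linarith
  have hw : ∀ t ∈ Set.Icc t₀ T, 1 ≤ Real.exp (k * (t - t₀)) := fun t ht =>
    Real.one_le_exp (mul_nonneg hkpos.le (sub_nonneg.2 ht.1))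
  have hint : ∀ c t, ∫ s in t₀..t, c * Real.exp (k * (s - t₀)) =
      c * ((Real.exp (k * (t - t₀)) - 1) / k) := by
    intro c t
    have hder : ∀ s ∈ Set.uIcc t₀ t, HasDerivAt (fun s => Real.exp (k * (s - t₀)) / k)
        (Real.exp (k * (s - t₀))) s := by
      intro s _
      refine ((((hasDerivAt_id s).sub_const t₀).const_mul k).exp.div_const k).congr_deriv ?_
      simp [hkpos.ne']
    rw [intervalIntegral.integral_const_mul, intervalIntegral.integral_eq_sub_of_hasDerivAt hder
      (Continuous.intervalIntegrable (by fun_prop) _ _)]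
    simp [sub_div]
  have step : ∀ n : ℕ, ∀ t ∈ Set.Icc t₀ T,
      d t ≤ (2 * a + |M| * (1 / 2) ^ n) * Real.exp (k * (t - t₀)) := by
    intro n
    induction n with
    | zero =>
      intro t ht
      have h₁ := hM t ht
      have h₂ := hw t ht
      have h₃ := le_abs_self M
      have h₄ := abs_nonneg M
      simp only [pow_zero, mul_one]
      nlinarith
    | succ n ih =>
      intro t ht
      set c := 2 * a + |M| * (1 / 2) ^ n with hc
      have hc0 : 0 ≤ c := by positivity
      have h₁ := h (fun s => c * Real.exp (k * (s - t₀))) (by fun_prop) ih t ht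
      rw [hint] at h₁
      have h₂ := hw t ht
      have h₃ : L * (c * ((Real.exp (k * (t - t₀)) - 1) / k)) ≤
          c / 2 * Real.exp (k * (t - t₀)) := by
        have h₄ : L / k ≤ 1 / 2 := by
          rw [div_le_div_iff₀ hkpos two_pos]
          linarith
        calc L * (c * ((Real.exp (k * (t - t₀)) - 1) / k))
            = L / k * (c * (Real.exp (k * (t - t₀)) - 1)) := by ring
          _ ≤ 1 / 2 * (c * (Real.exp (k * (t - t₀)) - 1)) := by
            gcongr
          _ ≤ c / 2 * Real.exp (k * (t - t₀)) := by linarith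
      have h₅ : 2 * a + |M| * (1 / 2) ^ (n + 1) = a + c / 2 := by
        rw [hc, pow_succ]
        ring
      rw [h₅]
      nlinarith
  intro t ht
  have hlim : Tendsto (fun n : ℕ => (2 * a + |M| * (1 / 2) ^ n) * Real.exp (k * (t - t₀))) atTop
      (nhds ((2 * a + |M| * 0) * Real.exp (k * (t - t₀)))) :=
    (((tendsto_pow_atTop_nhds_zero_of_lt_one (r := (1 / 2 : ℝ)) (by norm_num)
      (by norm_num)).const_mul _).const_add _).mul_const _
  simpa using ge_of_tendsto' hlim fun n => step n t ht

/-- If the drifts `B_n` (uniformly bounded and uniformly Lipschitz,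
with the same constants as `B`) satisfy `B_n(s, Y(s)) → B(s, Y(s))` for every
`s ∈ [t₀,T]`, then the mild solutions `Y_n` with drift `B_n` and data `(y,z)` converge
to the mild solution `Y` with drift `B` uniformly on `[t₀,T]`. -/
theorem mild_solutions_converge_of_drifts_converge
    {E : Type u} [NormedAddCommGroup E] [NormedSpace ℝ E] [CompleteSpace E]
    [MeasurableSpace E] [BorelSpace E]
    (T t₀ : ℝ) (hT : 0 < T) (ht₀ : t₀ ∈ Set.Ico (0:ℝ) T)
    (S : ℝ → E →L[ℝ] E) (C_A : ℝ)
    (hS0 : S 0 = ContinuousLinearMap.id ℝ E)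
    (hSsemi : ∀ s t : ℝ, 0 ≤ s → 0 ≤ t → s + t ≤ T → (S t).comp (S s) = S (s + t))
    (hSbd : ∀ t ∈ Set.Icc (0:ℝ) T, ‖S t‖ ≤ C_A)
    (hSmeas : Measurable fun p : ℝ × E => S p.1 p.2)
    (B : ℝ → E → E) (Bn : ℕ → ℝ → E → E) (Bsup K_B : ℝ)
    (hBmeas : Measurable (Function.uncurry B))
    (hBnmeas : ∀ n, Measurable (Function.uncurry (Bn n)))
    (hBbd : ∀ t x, ‖B t x‖ ≤ Bsup)
    (hBnbd : ∀ n t x, ‖Bn n t x‖ ≤ Bsup)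
    (hBlip : ∀ t x x', ‖B t x - B t x'‖ ≤ K_B * ‖x - x'‖)
    (hBnlip : ∀ n t x x', ‖Bn n t x - Bn n t x'‖ ≤ K_B * ‖x - x'‖)
    (y : E) (z : ℝ → E) (hz : BddMeasOn z t₀ T)
    (Y : ℝ → E) (hY : BddMeasOn Y t₀ T) (hYsol : IsMildSolution S B t₀ T y z Y)
    (Yn : ℕ → ℝ → E) (hYn : ∀ n, BddMeasOn (Yn n) t₀ T)
    (hYnsol : ∀ n, IsMildSolution S (Bn n) t₀ T y z (Yn n))
    (hconv : ∀ s ∈ Set.Icc t₀ T,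
      Tendsto (fun n => Bn n s (Y s)) atTop (nhds (B s (Y s)))) :
    TendstoUniformlyOn (fun n t => Yn n t) Y atTop (Set.Icc t₀ T) := by
  have hle : t₀ ≤ T := ht₀.2.le
  have hCA : 0 ≤ C_A := (norm_nonneg _).trans (hSbd 0 ⟨le_rfl, hT.le⟩)
  have hSt : ∀ t ∈ Set.Icc t₀ T, ∀ s ∈ Set.Icc t₀ t, ∀ v, ‖S (t - s) v‖ ≤ C_A * ‖v‖ := by
    intro t ht s hs v
    refine (S (t - s)).le_of_opNorm_le (hSbd _ ⟨sub_nonneg.2 hs.2, ?_⟩) v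
    linarith [ht.2, hs.1, ht₀.1]
  have hext : ∀ f : ℝ → E, BddMeasOn f t₀ T →
      ∃ f' : ℝ → E, Measurable f' ∧ ∀ s ∈ Set.Icc t₀ T, f' s = f s := fun f hf =>
    ⟨Set.IccExtend hle fun s : Set.Icc t₀ T => f s,
      hf.1.comp continuous_projIcc.measurable, fun s hs => Set.IccExtend_of_mem hle _ hs⟩
  have hInt : ∀ b : ℝ → E → E, Measurable (Function.uncurry b) → (∀ t x, ‖b t x‖ ≤ Bsup) →
      ∀ f : ℝ → E, BddMeasOn f t₀ T → ∀ t ∈ Set.Icc t₀ T,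
      IntervalIntegrable (fun s => S (t - s) (b s (f s))) volume t₀ t := by
    intro b hb hbd f hf t ht
    obtain ⟨f', hf', heq⟩ := hext f hf
    have hmeas : Measurable fun s => S (t - s) (b s (f' s)) :=
      hSmeas.comp ((measurable_const.sub measurable_id).prodMk (hb.comp (measurable_id.prodMk hf')))
    have hae : ∀ᵐ s ∂volume.restrict (Set.Ioc t₀ t), s ∈ Set.Ioc t₀ t :=
      ae_restrict_mem measurableSet_Ioc
    rw [intervalIntegrable_iff_integrableOn_Ioc_of_le ht.1]
    refine Integrable.of_bound (C := C_A * Bsup)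
      (hmeas.aestronglyMeasurable_of_polishSpace.congr ?_) ?_
    · filter_upwards [hae] with s hs
      simp only [heq s ⟨hs.1.le, hs.2.trans ht.2⟩]
    · filter_upwards [hae] with s hs
      exact (hSt t ht s ⟨hs.1.le, hs.2⟩ _).trans (mul_le_mul_of_nonneg_left (hbd _ _) hCA)
  obtain ⟨Y', hY', hYeq⟩ := hext Y hY
  let e : ℕ → ℝ → ℝ := fun n s => ‖Bn n s (Y' s) - B s (Y' s)‖
  have he0 : ∀ n s, 0 ≤ e n s := fun n s => norm_nonneg _
  have hebd : ∀ n s, ‖e n s‖ ≤ Bsup + Bsup := fun n s => by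
    rw [norm_norm]
    exact (norm_sub_le _ _).trans (add_le_add (hBnbd _ _ _) (hBbd _ _))
  have hemeas : ∀ n, AEStronglyMeasurable (e n) (volume.restrict (Set.Ioc t₀ T)) := fun n =>
    ((((hBnmeas n).comp (measurable_id.prodMk hY')).aestronglyMeasurable_of_polishSpace).sub
      ((hBmeas.comp (measurable_id.prodMk hY')).aestronglyMeasurable_of_polishSpace)).norm
  have heint : ∀ n, IntervalIntegrable (e n) volume t₀ T := fun n => by
    rw [intervalIntegrable_iff_integrableOn_Ioc_of_le hle]
    exact Integrable.of_bound (hemeas n) _ (Eventually.of_forall (hebd n))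
  let a : ℕ → ℝ := fun n => C_A * ∫ s in t₀..T, e n s
  have ha0 : ∀ n, 0 ≤ a n := fun n =>
    mul_nonneg hCA (intervalIntegral.integral_nonneg hle fun s _ => he0 n s)
  have ha : Tendsto a atTop (nhds 0) := by
    have h : Tendsto (fun n => ∫ s in t₀..T, e n s) atTop (nhds (∫ _ in t₀..T, (0 : ℝ))) := by
      refine intervalIntegral.tendsto_integral_filter_of_dominated_convergence
        (fun _ => Bsup + Bsup) (Eventually.of_forall fun n => ?_)
        (Eventually.of_forall fun n => Eventually.of_forall fun s _ => hebd n s)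
        intervalIntegrable_const (Eventually.of_forall fun s hs => ?_)
      · rw [Set.uIoc_of_le hle]
        exact hemeas n
      · rw [Set.uIoc_of_le hle] at hs
        have hs' : s ∈ Set.Icc t₀ T := ⟨hs.1.le, hs.2⟩
        simp only [e, hYeq s hs']
        simpa using ((hconv s hs').sub_const (B s (Y s))).norm
    simpa using h.const_mul C_A
  have hbound : ∀ n, ∀ t ∈ Set.Icc t₀ T, ‖Yn n t - Y t‖ ≤
      2 * a n * Real.exp ((2 * (C_A * |K_B|) + 1) * (t - t₀)) := by
    intro n
    obtain ⟨M, hM⟩ := hY.2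
    obtain ⟨Mn, hMn⟩ := (hYn n).2
    refine le_two_mul_exp_of_forall_continuous_majorant (ha0 n)
      (mul_nonneg hCA (abs_nonneg _)) (M := Mn + M)
      (fun t ht => (norm_sub_le _ _).trans (add_le_add (hMn t ht) (hM t ht))) ?_
    intro g hg hdg t ht
    have hI₁ := hInt (Bn n) (hBnmeas n) (hBnbd n) (Yn n) (hYn n) t ht
    have hI₂ := hInt B hBmeas hBbd Y hY t ht
    have het : IntervalIntegrable (e n) volume t₀ t := (heint n).mono_set
      (by rw [Set.uIcc_of_le ht.1, Set.uIcc_of_le hle]; exact Set.Icc_subset_Icc_right ht.2)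
    have hdiff : Yn n t - Y t =
        ∫ s in t₀..t, (S (t - s) (Bn n s (Yn n s)) - S (t - s) (B s (Y s))) := by
      rw [intervalIntegral.integral_sub hI₁ hI₂, hYnsol n t ht, hYsol t ht]
      abel
    have hg' : IntervalIntegrable (fun s => C_A * |K_B| * g s) volume t₀ t :=
      (hg.const_mul _).intervalIntegrable _ _
    rw [hdiff]
    calc ‖∫ s in t₀..t, (S (t - s) (Bn n s (Yn n s)) - S (t - s) (B s (Y s)))‖
        ≤ ∫ s in t₀..t, (C_A * |K_B| * g s + C_A * e n s) := by
          refine intervalIntegral.norm_integral_le_of_norm_le ht.1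
            (Eventually.of_forall fun s hs => ?_) (hg'.add (het.const_mul _))
          have hs' : s ∈ Set.Icc t₀ T := ⟨hs.1.le, hs.2.trans ht.2⟩
          rw [← map_sub]
          refine (hSt t ht s ⟨hs.1.le, hs.2⟩ _).trans ?_
          rw [mul_assoc, ← mul_add]
          refine mul_le_mul_of_nonneg_left ?_ hCA
          simp only [e, hYeq s hs']
          refine (norm_sub_le_norm_sub_add_norm_sub _ (Bn n s (Y s)) _).trans
            (add_le_add ((hBnlip n _ _ _).trans ?_) le_rfl)
          exact mul_le_mul (le_abs_self _) (hdg s hs') (norm_nonneg _) (abs_nonneg _)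
      _ = C_A * |K_B| * (∫ s in t₀..t, g s) + C_A * ∫ s in t₀..t, e n s := by
          rw [intervalIntegral.integral_add hg' (het.const_mul _),
            intervalIntegral.integral_const_mul, intervalIntegral.integral_const_mul]
      _ ≤ C_A * |K_B| * (∫ s in t₀..t, g s) + a n := by
          gcongr
          exact mul_le_mul_of_nonneg_left (intervalIntegral.integral_mono_interval le_rfl ht.1 ht.2
            (Eventually.of_forall (he0 n)) (heint n)) hCA
      _ = a n + C_A * |K_B| * ∫ s in t₀..t, g s := add_comm _ _
  have hlim : Tendsto (fun n => 2 * a n * Real.exp ((2 * (C_A * |K_B|) + 1) * (T - t₀))) atTop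
      (nhds 0) := by
    simpa using (ha.const_mul 2).mul_const (Real.exp ((2 * (C_A * |K_B|) + 1) * (T - t₀)))
  refine Metric.tendstoUniformlyOn_iff.2 fun ε hε => ?_
  filter_upwards [hlim.eventually_lt_const hε] with n hn t ht
  rw [dist_comm, dist_eq_norm]
  refine ((hbound n t ht).trans ?_).trans_lt hn
  have := ha0 n
  gcongr
  exact ht.2
end
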